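/- Let β > 0 and assume that every conditional distribution minimizing L_β is a fixed point of BA_β in encoder coordinates (BA_β[q] = q). If there exist two distinct minimizers q' ≠ q'' of L_β, then for every minimizer q of L_β the derivative at q of the map q ↦ q − BA_β[q] on ℝ^{𝒳̂×𝒳} has nontrivial kernel: there exists v ≠ 0 in ℝ^{𝒳̂×𝒳} with D(Id − BA_β)(q)[v] = 0. -/

import Mathlib

open scoped BigOperators

variable {X Xhat : Type*} [Fintype X] [Fintype Xhat]

/-- `q` is a conditional distribution: each `q(·|x)` is a probability distribution on `𝒳̂`. -/
def IsCond (q : Xhat → X → ℝ) : Prop :=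
  ∀ x : X, (∀ xh : Xhat, 0 ≤ q xh x) ∧ ∑ xh : Xhat, q xh x = 1

/-- The marginal `s(x̂) = ∑_x p_X(x)·q(x̂|x)`. -/
noncomputable def margQ (p : X → ℝ) (q : Xhat → X → ℝ) (xh : Xhat) : ℝ :=
  ∑ x : X, p x * q xh x

/-- The Blahut–Arimoto iteration in encoder coordinates:
`BA_β[q](x̂|x) = s(x̂)·e^{−β d(x,x̂)} / ∑_{x̂''} s(x̂'')·e^{−β d(x,x̂'')}`. -/
noncomputable def BAenc (p : X → ℝ) (d : X → Xhat → ℝ) (β : ℝ) (q : Xhat → X → ℝ) :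
    Xhat → X → ℝ :=
  fun xh x =>
    margQ p q xh * Real.exp (-β * d x xh) /
      ∑ xh'' : Xhat, margQ p q xh'' * Real.exp (-β * d x xh'')

/-- The mutual information
`I(q) = ∑_{x,x̂ : p(x)q(x̂|x) > 0} p(x)·q(x̂|x)·log(q(x̂|x)/q(x̂))`. -/
noncomputable def mutualInfo (p : X → ℝ) (q : Xhat → X → ℝ) : ℝ :=
  ∑ x : X, ∑ xh : Xhat,
    if 0 < p x * q xh x then p x * q xh x * Real.log (q xh x / margQ p q xh) else 0

/-- The expected distortion `D(q) = ∑_{x,x̂} p(x)·q(x̂|x)·d(x,x̂)`. -/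
noncomputable def expDist (p : X → ℝ) (d : X → Xhat → ℝ) (q : Xhat → X → ℝ) : ℝ :=
  ∑ x : X, ∑ xh : Xhat, p x * q xh x * d x xh

/-- The rate-distortion Lagrangian `L_β(q) = I(q) + β·D(q)`. -/
noncomputable def Lagr (p : X → ℝ) (d : X → Xhat → ℝ) (β : ℝ) (q : Xhat → X → ℝ) : ℝ :=
  mutualInfo p q + β * expDist p d q

/-- `q` attains the minimum of `L_β` over all conditional distributions. -/
def IsMinimizer (p : X → ℝ) (d : X → Xhat → ℝ) (β : ℝ) (q : Xhat → X → ℝ) : Prop :=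
  IsCond q ∧ ∀ q' : Xhat → X → ℝ, IsCond q' → Lagr p d β q ≤ Lagr p d β q'

/-- The tangent-line bound for the perspective of `u ↦ u log u`. -/
theorem tangent_le_mul_log_div {a c r : ℝ} (ha : 0 ≤ a) (hc : 0 ≤ c) (hac : 0 < a → 0 < c)
    (hr : 0 < r) : a * Real.log r + a - c * r ≤ a * Real.log (a / c) := by
  rcases ha.eq_or_lt with rfl | ha
  · simp only [zero_mul, zero_add, zero_sub, Left.neg_nonpos_iff]
    positivity
  · have hc := hac ha
    have h := mul_le_mul_of_nonneg_left
      (Real.log_le_sub_one_of_pos (x := r / (a / c)) (by positivity)) ha.le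
    rw [Real.log_div hr.ne' (by positivity)] at h
    have e : a * (r / (a / c) - 1) = c * r - a := by field_simp
    linarith

/-- The log-sum inequality for two terms. -/
theorem add_mul_log_div_add_le {a b c e : ℝ} (ha : 0 ≤ a) (hb : 0 ≤ b) (hc : 0 ≤ c) (he : 0 ≤ e)
    (hac : 0 < a → 0 < c) (hbe : 0 < b → 0 < e) :
    (a + b) * Real.log ((a + b) / (c + e)) ≤
      a * Real.log (a / c) + b * Real.log (b / e) := by
  rcases (add_nonneg ha hb).eq_or_lt with hab | hab
  · obtain rfl : a = 0 := by linarith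
    obtain rfl : b = 0 := by linarith
    simp
  · have hce : 0 < c + e := by
      rcases ha.eq_or_lt with rfl | ha'
      · have := hbe (by linarith)
        linarith
      · have := hac ha'
        linarith
    have hr : 0 < (a + b) / (c + e) := by positivity
    have h₁ := tangent_le_mul_log_div ha hc hac hr
    have h₂ := tangent_le_mul_log_div hb he hbe hr
    have h₃ : c * ((a + b) / (c + e)) + e * ((a + b) / (c + e)) = a + b := by field_simp
    linarith

theorem margQ_nonneg {p : X → ℝ} (hp0 : ∀ x, 0 ≤ p x) {q : Xhat → X → ℝ} (hq : IsCond q)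
    (xh : Xhat) : 0 ≤ margQ p q xh :=
  Finset.sum_nonneg fun x _ => mul_nonneg (hp0 x) ((hq x).1 xh)

theorem margQ_pos {p : X → ℝ} (hp0 : ∀ x, 0 ≤ p x) {q : Xhat → X → ℝ} (hq : IsCond q)
    {x : X} {xh : Xhat} (h : 0 < p x * q xh x) : 0 < margQ p q xh :=
  Finset.sum_pos' (fun y _ => mul_nonneg (hp0 y) ((hq y).1 xh)) ⟨x, Finset.mem_univ x, h⟩

theorem sum_margQ {p : X → ℝ} (hp1 : ∑ x, p x = 1) {q : Xhat → X → ℝ} (hq : IsCond q) :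
    ∑ xh, margQ p q xh = 1 := by
  simp only [margQ]
  rw [Finset.sum_comm, ← hp1]
  exact Finset.sum_congr rfl fun x _ => by rw [← Finset.mul_sum, (hq x).2, mul_one]

theorem margQ_add_smul {Y : Type*} (p : X → ℝ) (a b : ℝ) (q r : Y → X → ℝ) (xh : Y) :
    margQ p (a • q + b • r) xh = a * margQ p q xh + b * margQ p r xh := by
  simp only [margQ, Finset.mul_sum, ← Finset.sum_add_distrib, Pi.add_apply, Pi.smul_apply,
    smul_eq_mul]
  exact Finset.sum_congr rfl fun x _ => by ring

theorem expDist_add_smul (p : X → ℝ) (d : X → Xhat → ℝ) (a b : ℝ) (q r : Xhat → X → ℝ) :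
    expDist p d (a • q + b • r) = a * expDist p d q + b * expDist p d r := by
  simp only [expDist, Finset.mul_sum, ← Finset.sum_add_distrib, Pi.add_apply, Pi.smul_apply,
    smul_eq_mul]
  exact Finset.sum_congr rfl fun x _ => Finset.sum_congr rfl fun xh _ => by ring

theorem mutualInfo_eq_sum {p : X → ℝ} (hp0 : ∀ x, 0 ≤ p x) {q : Xhat → X → ℝ} (hq : IsCond q) :
    mutualInfo p q = ∑ x, ∑ xh, p x * (q xh x * Real.log (q xh x / margQ p q xh)) := by
  refine Finset.sum_congr rfl fun x _ => Finset.sum_congr rfl fun xh _ => ?_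
  split_ifs with h
  · ring
  · have h0 : p x * q xh x = 0 := le_antisymm (not_lt.1 h) (mul_nonneg (hp0 x) ((hq x).1 xh))
    rw [← mul_assoc, h0, zero_mul]

theorem convex_setOf_isCond {Y : Type*} : Convex ℝ {q : Xhat → Y → ℝ | IsCond q} := by
  intro q hq r hr a b ha hb hab x
  refine ⟨fun xh => ?_, ?_⟩
  · have := (hq x).1 xh
    have := (hr x).1 xh
    simp only [Pi.add_apply, Pi.smul_apply, smul_eq_mul]
    positivity
  · simp only [Pi.add_apply, Pi.smul_apply, smul_eq_mul, Finset.sum_add_distrib,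
      ← Finset.mul_sum, (hq x).2, (hr x).2, mul_one, hab]

theorem convexOn_mutualInfo {p : X → ℝ} (hp0 : ∀ x, 0 ≤ p x) :
    ConvexOn ℝ {q : Xhat → X → ℝ | IsCond q} (mutualInfo p) := by
  refine convexOn_iff_forall_pos.2 ⟨convex_setOf_isCond, fun q hq r hr a b ha hb hab => ?_⟩
  rw [mutualInfo_eq_sum hp0 hq, mutualInfo_eq_sum hp0 hr,
    mutualInfo_eq_sum hp0 (convex_setOf_isCond hq hr ha.le hb.le hab)]
  simp only [smul_eq_mul, Finset.mul_sum, ← Finset.sum_add_distrib]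
  refine Finset.sum_le_sum fun x _ => Finset.sum_le_sum fun xh _ => ?_
  rcases (hp0 x).eq_or_lt with hx | hx
  · simp [← hx]
  · have pos_of_pos {c : ℝ} {w : Xhat → X → ℝ} (hc : 0 < c) (hw : IsCond w)
        (h : 0 < c * w xh x) : 0 < c * margQ p w xh :=
      mul_pos hc (margQ_pos hp0 hw (mul_pos hx (pos_of_mul_pos_right h hc.le)))
    have h := add_mul_log_div_add_le
      (mul_nonneg ha.le ((hq x).1 xh)) (mul_nonneg hb.le ((hr x).1 xh))
      (mul_nonneg ha.le (margQ_nonneg hp0 hq xh)) (mul_nonneg hb.le (margQ_nonneg hp0 hr xh))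
      (pos_of_pos ha hq) (pos_of_pos hb hr)
    rw [mul_div_mul_left _ _ ha.ne', mul_div_mul_left _ _ hb.ne'] at h
    rw [margQ_add_smul]
    simp only [Pi.add_apply, Pi.smul_apply, smul_eq_mul]
    linarith [mul_le_mul_of_nonneg_left h hx.le]

theorem convexOn_Lagr {p : X → ℝ} (hp0 : ∀ x, 0 ≤ p x) (d : X → Xhat → ℝ) (β : ℝ) :
    ConvexOn ℝ {q : Xhat → X → ℝ | IsCond q} (Lagr p d β) := by
  refine ⟨convex_setOf_isCond, fun q hq r hr a b ha hb hab => ?_⟩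
  have h := (convexOn_mutualInfo hp0).2 hq hr ha hb hab
  simp only [Lagr, expDist_add_smul, smul_eq_mul] at h ⊢
  linarith

theorem convex_setOf_isMinimizer {p : X → ℝ} (hp0 : ∀ x, 0 ≤ p x) (d : X → Xhat → ℝ) (β : ℝ) :
    Convex ℝ {q : Xhat → X → ℝ | IsMinimizer p d β q} := by
  intro q hq r hr a b ha hb hab
  have h := (convexOn_Lagr hp0 d β).convex_le (Lagr p d β q)
    ⟨hq.1, le_rfl⟩ ⟨hr.1, hr.2 q hq.1⟩ ha hb hab
  exact ⟨h.1, fun w hw => h.2.trans (hq.2 w hw)⟩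

theorem differentiableAt_BAenc {p : X → ℝ} (hp0 : ∀ x, 0 ≤ p x) (hp1 : ∑ x, p x = 1)
    (d : X → Xhat → ℝ) (β : ℝ) {q : Xhat → X → ℝ} (hq : IsCond q) :
    DifferentiableAt ℝ (BAenc p d β) q := by
  have hden (x : X) : ∑ xh, margQ p q xh * Real.exp (-β * d x xh) ≠ 0 := by
    obtain ⟨xh, -, h⟩ : ∃ xh ∈ Finset.univ, margQ p q xh ≠ 0 :=
      Finset.exists_ne_zero_of_sum_ne_zero (by rw [sum_margQ hp1 hq]; exact one_ne_zero)
    refine (Finset.sum_pos'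
      (fun y _ => mul_nonneg (margQ_nonneg hp0 hq y) (Real.exp_pos _).le) ⟨xh, Finset.mem_univ xh,
        mul_pos ((margQ_nonneg hp0 hq xh).lt_of_ne' h) (Real.exp_pos _)⟩).ne'
  refine differentiableAt_pi.2 fun xh => differentiableAt_pi.2 fun x => ?_
  have hmarg (y : Xhat) : DifferentiableAt ℝ (fun w => margQ p w y) q := by
    simp only [margQ]
    fun_prop
  have hsum : DifferentiableAt ℝ
      (fun w : Xhat → X → ℝ => ∑ y, margQ p w y * Real.exp (-β * d x y)) q :=
    DifferentiableAt.fun_sum fun y _ => (hmarg y).mul_const _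
  exact ((hmarg xh).mul_const _).mul (hsum.inv (hden x))

/-- If `f` vanishes on the segment from `x` to `y`, its derivative at `x` kills `y - x`. -/
theorem fderiv_sub_eq_zero_of_segment {E F : Type*} [NormedAddCommGroup E] [NormedSpace ℝ E]
    [NormedAddCommGroup F] [NormedSpace ℝ F] {f : E → F} {x y : E}
    (hf : DifferentiableAt ℝ f x) (h : ∀ z ∈ segment ℝ x y, f z = 0) :
    fderiv ℝ f x (y - x) = 0 := by
  have hline : HasDerivWithinAt (fun t : ℝ => f (x + t • (y - x))) (fderiv ℝ f x (y - x))
      (Set.Icc 0 1) 0 := (hf.hasFDerivAt.hasLineDerivAt (y - x)).hasDerivWithinAt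
  have hmem : (0 : ℝ) ∈ Set.Icc (0 : ℝ) 1 := Set.left_mem_Icc.2 zero_le_one
  have hzero : Set.EqOn (fun _ : ℝ => (0 : F)) (fun t => f (x + t • (y - x))) (Set.Icc 0 1) :=
    fun t ht => (h _ (segment_eq_image' ℝ x y ▸ Set.mem_image_of_mem _ ht)).symm
  exact (uniqueDiffOn_Icc zero_lt_one 0 hmem).eq_deriv _
    (hline.congr hzero (hzero hmem)) (hasDerivWithinAt_const 0 _ 0)

/-- **Non-uniqueness of RD solutions is detectable by the encoder Jacobian** (Corollary
`cor:multiple-RD-sols-are-detectable-by-Jacobian`): if the minimizers of `L_β` are fixed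
points of `BA_β` and there are two distinct minimizers, then at every minimizer `q` the
derivative of `q ↦ q − BA_β[q]` has a nontrivial kernel. -/
theorem nonUniquenessDetectable (p : X → ℝ) (hp0 : ∀ x, 0 ≤ p x) (hp1 : ∑ x, p x = 1)
    (d : X → Xhat → ℝ) (β : ℝ) (hβ : 0 < β)
    (hfix : ∀ q : Xhat → X → ℝ, IsMinimizer p d β q → BAenc p d β q = q)
    (hne : ∃ q' q'' : Xhat → X → ℝ,
      IsMinimizer p d β q' ∧ IsMinimizer p d β q'' ∧ q' ≠ q'') :
    ∀ q : Xhat → X → ℝ, IsMinimizer p d β q →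
      ∃ v : Xhat → X → ℝ, v ≠ 0 ∧
        fderiv ℝ (fun q' : Xhat → X → ℝ => q' - BAenc p d β q') q v = 0 := by
  intro q hq
  obtain ⟨r, hr, hrq⟩ : ∃ r, IsMinimizer p d β r ∧ r ≠ q := by
    obtain ⟨r₁, r₂, h₁, h₂, h⟩ := hne
    by_cases hr : r₁ = q
    · exact ⟨r₂, h₂, fun h' => h (hr.trans h'.symm)⟩
    · exact ⟨r₁, h₁, hr⟩
  refine ⟨r - q, sub_ne_zero.2 hrq, fderiv_sub_eq_zero_of_segment
    (differentiableAt_id.sub (differentiableAt_BAenc hp0 hp1 d β hq.1)) fun w hw => ?_⟩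
  exact sub_eq_zero.2 (hfix w ((convex_setOf_isMinimizer hp0 d β).segment_subset hq hr hw)).symm
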